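/- arXiv:1803.11176 — 2 statements merged into one kernel-verified Lean document; each statement's English description precedes it below -/
import Mathlib

section
/- Let n > 2 be an integer, k ∈ {1, ..., n-2}, and x ∈ (0, (n-1)/(2n-k-2)). Then φ_{n,k}(x) ≤ (1/2)·(1 − 1/(1 − x − ((n-k-1)/(n-1))x)) + x^2(2−x)/(4(n-1)(1−x)^2) + ((n-1)/x)·ln( (1 − x − ((n-k-1)/(n-1))x) / (1−x)^2 ). -/
/-- The function `φ_{n,k}` from Lemma 3 of the paper. -/
noncomputable def phi (n k : ℕ) (x : ℝ) : ℝ :=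
  (∑ i ∈ Finset.range n, 1 / (1 - (i / ((n : ℝ) - 1)) * x))
    - ∑ i ∈ Finset.range (n - k), 1 / (1 - x - (i / ((n : ℝ) - 1)) * x)

lemma step_upper (a b : ℝ) (hb : 0 < b) (hab : b < a) :
    (1 / a + 1 / b) / 2 ≤ (1 / (a - b)) * (Real.log a - Real.log b)
      + (a - b) / 4 * (1 / b ^ 2 - 1 / a ^ 2) := by
  have ha : 0 < a := hb.trans hab
  have hh : 0 < a - b := sub_pos.2 hab
  have h1 : 2 * (a - b) / (a + b) ≤ Real.log a - Real.log b := by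
    have h := Real.le_log_one_add_of_nonneg (x := (a - b) / b) (by positivity)
    have e1 : 1 + (a - b) / b = a / b := by field_simp; ring
    have e2 : 2 * ((a - b) / b) / ((a - b) / b + 2) = 2 * (a - b) / (a + b) := by
      have : (a - b) / b + 2 = (a + b) / b := by field_simp; ring
      rw [this]; field_simp
    rw [e1, e2, Real.log_div ha.ne' hb.ne'] at h
    exact h
  have h2 : 2 / (a + b) ≤ (1 / (a - b)) * (Real.log a - Real.log b) := by
    calc 2 / (a + b) = (1 / (a - b)) * (2 * (a - b) / (a + b)) := by field_simp
      _ ≤ _ := by gcongr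
  have h3 : 2 / (a + b) + (a - b) / 4 * (1 / b ^ 2 - 1 / a ^ 2) - (1 / a + 1 / b) / 2
      = (a - b) ^ 2 * (a ^ 2 + b ^ 2) / (4 * a ^ 2 * b ^ 2 * (a + b)) := by
    field_simp; ring
  have h4 : 0 ≤ (a - b) ^ 2 * (a ^ 2 + b ^ 2) / (4 * a ^ 2 * b ^ 2 * (a + b)) := by positivity
  linarith

lemma step_lower (a b : ℝ) (hb : 0 < b) (hab : b < a) :
    (1 / (a - b)) * (Real.log a - Real.log b) ≤ (1 / a + 1 / b) / 2 := by
  have ha : 0 < a := hb.trans hab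
  have hh : 0 < a - b := sub_pos.2 hab
  have h := Real.self_le_sinh_iff.2 (Real.log_nonneg ((one_le_div hb).2 hab.le))
  rw [Real.sinh_log (by positivity), Real.log_div ha.ne' hb.ne'] at h
  calc _ ≤ (1 / (a - b)) * ((a / b - (a / b)⁻¹) / 2) := by gcongr
    _ = _ := by field_simp; ring

lemma sum_upper (p h : ℝ) (hh : 0 < h) (N : ℕ) (hN : 0 < p - N * h) :
    ∑ i ∈ Finset.range (N + 1), 1 / (p - i * h) ≤ (1 / p + 1 / (p - N * h)) / 2
      + (1 / h) * (Real.log p - Real.log (p - N * h))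
      + h / 4 * (1 / (p - N * h) ^ 2 - 1 / p ^ 2) := by
  induction N with
  | zero => simp
  | succ N ih =>
    rw [Finset.sum_range_succ]
    push_cast at hN ⊢
    have := ih (by linarith)
    have h2 := step_upper (p - N * h) (p - (N + 1) * h) hN (by linarith)
    have e : p - N * h - (p - (N + 1) * h) = h := by ring
    rw [e] at h2
    linarith

lemma sum_lower (p h : ℝ) (hh : 0 < h) (N : ℕ) (hN : 0 < p - N * h) :
    (1 / p + 1 / (p - N * h)) / 2 + (1 / h) * (Real.log p - Real.log (p - N * h))
      ≤ ∑ i ∈ Finset.range (N + 1), 1 / (p - i * h) := by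
  induction N with
  | zero => simp
  | succ N ih =>
    rw [Finset.sum_range_succ]
    push_cast at hN ⊢
    have := ih (by linarith)
    have h2 := step_lower (p - N * h) (p - (N + 1) * h) hN (by linarith)
    have e : p - N * h - (p - (N + 1) * h) = h := by ring
    rw [e] at h2
    linarith

/-- Upper bound for `φ_{n,k}(x)` for `n > 2`, `1 ≤ k ≤ n - 2`, and
`0 < x < (n-1)/(2n-k-2)`. -/
theorem phi_upper_bound (n k : ℕ) (hn : 2 < n) (hk1 : 1 ≤ k) (hk2 : k ≤ n - 2)
    (x : ℝ) (hx0 : 0 < x) (hx1 : x < ((n : ℝ) - 1) / (2 * (n : ℝ) - (k : ℝ) - 2)) :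
    phi n k x ≤
      (1 / 2) * (1 - 1 / (1 - x - (((n : ℝ) - (k : ℝ) - 1) / ((n : ℝ) - 1)) * x))
        + x ^ 2 * (2 - x) / (4 * ((n : ℝ) - 1) * (1 - x) ^ 2)
        + (((n : ℝ) - 1) / x) *
            Real.log ((1 - x - (((n : ℝ) - (k : ℝ) - 1) / ((n : ℝ) - 1)) * x)
              / (1 - x) ^ 2) := by
  obtain ⟨j, rfl⟩ : ∃ j, n = k + j + 1 := ⟨n - k - 1, by omega⟩
  have hj : 1 ≤ j := by omega
  have hkR : (1 : ℝ) ≤ k := by exact_mod_cast hk1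
  have hjR : (1 : ℝ) ≤ j := by exact_mod_cast hj
  unfold phi
  rw [show k + j + 1 - k = j + 1 by omega]
  push_cast at hx1 ⊢
  have em : (k : ℝ) + j + 1 - 1 = k + j := by ring
  have ej : (k : ℝ) + j + 1 - k - 1 = j := by ring
  rw [em] at hx1
  rw [em, ej]
  have hm : (0 : ℝ) < k + j := by linarith
  rw [lt_div_iff₀ (by linarith)] at hx1
  have hD : 0 < 1 - x - j * (x / (k + j)) := by
    have : 1 - x - j * (x / (k + j)) = (k + j - x * (k + 2 * j)) / (k + j) := by
      field_simp; ring
    rw [this]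
    apply div_pos _ hm
    linarith
  have hh : 0 < x / (k + j : ℝ) := by positivity
  have hx : 0 < 1 - x := by
    have : 0 < j * (x / (k + j : ℝ)) := by positivity
    linarith
  have eN : (1 : ℝ) - ((k + j : ℕ) : ℝ) * (x / (k + j)) = 1 - x := by
    push_cast; field_simp
  have u := sum_upper 1 (x / (k + j)) hh (k + j) (by rw [eN]; exact hx)
  have l := sum_lower (1 - x) (x / (k + j)) hh j hD
  rw [eN] at u
  have e1 : ∀ i : ℕ, (i : ℝ) / (k + j) * x = i * (x / (k + j)) := fun i => by ring
  simp only [e1]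
  rw [Real.log_div hD.ne' (by positivity), Real.log_pow]
  rw [Real.log_one] at u
  have e2 : x / (k + j) / 4 * (1 / (1 - x) ^ 2 - 1 / 1 ^ 2)
      = x ^ 2 * (2 - x) / (4 * (k + j) * (1 - x) ^ 2) := by
    field_simp; ring
  have e3 : 1 / (x / (k + j : ℝ)) = (k + j) / x := by rw [one_div_div]
  rw [e2, e3] at u
  rw [e3] at l
  push_cast
  linarith
end

section
/- Let n ≥ 2 be an integer and k ∈ {1, ..., n-1}. For every x ∈ (0, 1/2), p_{n,k} is differentiable at x with p_{n,k}'(x) = p_{n,k}(x) · φ_{n,k}(x)/x, and for every x ∈ (1/2, 1), p_{n,k} is differentiable at x with p_{n,k}'(x) = −p_{n,k}(x) · φ_{n,n-k}(1−x)/(1−x). -/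
/-- Rising factorial with increment `h`: `t^{(j,h)} = ∏_{i=0}^{j-1} (t + i·h)`. -/
def risingFac (t h : ℝ) (j : ℕ) : ℝ :=
  ∏ i ∈ Finset.range j, (t + i * h)

/-- The Pólya urn probabilities with minimal negative replacement
`c(x) = −min(x, 1−x)/(n−1)`:
`p_{n,k}(x) = C(n,k)·x^{(k,c(x))}·(1−x)^{(n−k,c(x))}/1^{(n,c(x))}`. -/
noncomputable def polyaP (n k : ℕ) (x : ℝ) : ℝ :=
  (n.choose k : ℝ)
    * risingFac x (-min x (1 - x) / ((n : ℝ) - 1)) k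
    * risingFac (1 - x) (-min x (1 - x) / ((n : ℝ) - 1)) (n - k)
    / risingFac 1 (-min x (1 - x) / ((n : ℝ) - 1)) n


lemma prod_aux (b : ℕ → ℝ) (x : ℝ) (hx : x ≠ 0) (m : ℕ)
    (h : ∀ i < m, 1 - b i * x ≠ 0) :
    HasDerivAt (fun y => ∏ i ∈ Finset.range m, (1 - b i * y))
      ((∏ i ∈ Finset.range m, (1 - b i * x)) *
        ((m : ℝ) - ∑ i ∈ Finset.range m, 1 / (1 - b i * x)) / x) x := by
  induction m with
  | zero => simpa using hasDerivAt_const x (1 : ℝ)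
  | succ m ih =>
    have h1 := ih (fun i hi => h i (by omega))
    have h2 : HasDerivAt (fun y => 1 - b m * y) (-(b m)) x := by
      simpa using ((hasDerivAt_id x).const_mul (b m)).const_sub 1
    have h3 := h1.mul h2
    have hm := h m (by omega)
    simp only [Finset.prod_range_succ, Finset.sum_range_succ]
    refine h3.congr_deriv ?_
    push_cast
    generalize (∏ i ∈ Finset.range m, (1 - b i * x)) = P
    generalize (∑ i ∈ Finset.range m, 1 / (1 - b i * x)) = S
    have hinv : (1 - b m * x) * (1 / (1 - b m * x)) = 1 := mul_one_div_cancel hm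
    generalize 1 / (1 - b m * x) = w at *
    rw [eq_div_iff hx, add_mul, mul_assoc (_ / x), mul_comm (1 - b m * x) x, ← mul_assoc (_ / x),
      div_mul_cancel₀ _ hx]
    linear_combination P * hinv

lemma polyaP_eq (n k : ℕ) (y : ℝ) (hy : y ≤ 1 / 2) :
    polyaP n k y = (n.choose k : ℝ) * (∏ i ∈ Finset.range k, (1 - (i / ((n : ℝ) - 1)))) *
      (y ^ k * (∏ i ∈ Finset.range (n - k), (1 - (1 + i / ((n : ℝ) - 1)) * y)) /
        ∏ i ∈ Finset.range n, (1 - (i / ((n : ℝ) - 1)) * y)) := by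
  have hm : min y (1 - y) = y := min_eq_left (by linarith)
  unfold polyaP risingFac
  rw [hm]
  have e1 : ∏ i ∈ Finset.range k, (y + i * (-y / ((n : ℝ) - 1)))
      = y ^ k * ∏ i ∈ Finset.range k, (1 - (i / ((n : ℝ) - 1))) := by
    have : y ^ k = ∏ _i ∈ Finset.range k, y := by simp
    rw [this, ← Finset.prod_mul_distrib]
    exact Finset.prod_congr rfl fun i _ => by ring
  have e2 : ∏ i ∈ Finset.range (n - k), (1 - y + i * (-y / ((n : ℝ) - 1)))
      = ∏ i ∈ Finset.range (n - k), (1 - (1 + i / ((n : ℝ) - 1)) * y) :=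
    Finset.prod_congr rfl fun i _ => by ring
  have e3 : ∏ i ∈ Finset.range n, (1 + i * (-y / ((n : ℝ) - 1)))
      = ∏ i ∈ Finset.range n, (1 - (i / ((n : ℝ) - 1)) * y) :=
    Finset.prod_congr rfl fun i _ => by ring
  rw [e1, e2, e3]
  ring

lemma polyaP_left (n k : ℕ) (hn : 2 ≤ n) (hk1 : 1 ≤ k) (hk2 : k ≤ n - 1)
    (x : ℝ) (hx0 : 0 < x) (hx1 : x < 1 / 2) :
    HasDerivAt (fun y => polyaP n k y) (polyaP n k x * phi n k x / x) x := by
  have hx : x ≠ 0 := hx0.ne'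
  have hn1 : (0 : ℝ) < (n : ℝ) - 1 := by
    have : (2 : ℝ) ≤ n := by exact_mod_cast hn
    linarith
  have ha : ∀ i < n, (i / ((n : ℝ) - 1)) ≤ 1 := by
    intro i hi
    rw [div_le_one hn1]
    have : (i : ℝ) + 1 ≤ n := by exact_mod_cast hi
    linarith
  have hA : ∀ i < n, 1 - (i / ((n : ℝ) - 1)) * x ≠ 0 := by
    intro i hi
    have := ha i hi
    nlinarith
  have hB : ∀ i < n - k, 1 - (1 + i / ((n : ℝ) - 1)) * x ≠ 0 := by
    intro i hi
    have := ha i (by omega)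
    nlinarith
  have dA := prod_aux (fun i => i / ((n : ℝ) - 1)) x hx n hA
  have dB := prod_aux (fun i => 1 + i / ((n : ℝ) - 1)) x hx (n - k) hB
  have hP : (∏ i ∈ Finset.range n, (1 - (i / ((n : ℝ) - 1)) * x)) ≠ 0 :=
    Finset.prod_ne_zero_iff.mpr fun i hi => hA i (Finset.mem_range.mp hi)
  have d := (((hasDerivAt_pow k x).mul dB).div dA hP).const_mul
    ((n.choose k : ℝ) * (∏ i ∈ Finset.range k, (1 - (i / ((n : ℝ) - 1)))))
  have hev : (fun y => polyaP n k y) =ᶠ[nhds x] _ :=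
    Filter.eventually_of_mem (Iio_mem_nhds hx1) (fun y hy => polyaP_eq n k y (le_of_lt hy))
  refine (HasDerivAt.congr_of_eventuallyEq d hev).congr_deriv ?_
  rw [polyaP_eq n k x hx1.le]
  unfold phi
  have e : ∑ i ∈ Finset.range (n - k), 1 / (1 - x - (i / ((n : ℝ) - 1)) * x)
      = ∑ i ∈ Finset.range (n - k), 1 / (1 - (1 + i / ((n : ℝ) - 1)) * x) :=
    Finset.sum_congr rfl fun i _ => by congr 1; ring
  rw [e, Nat.cast_sub (by omega : k ≤ n)]
  obtain ⟨j, rfl⟩ : ∃ j, k = j + 1 := ⟨k - 1, by omega⟩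
  simp only [Pi.mul_apply]
  generalize (∏ i ∈ Finset.range n, (1 - (i / ((n : ℝ) - 1)) * x)) = P at *
  generalize (∏ i ∈ Finset.range (n - (j + 1)), (1 - (1 + i / ((n : ℝ) - 1)) * x)) = Q
  generalize (∏ i ∈ Finset.range (j + 1), (1 - (i / ((n : ℝ) - 1)))) = R
  generalize (∑ i ∈ Finset.range n, 1 / (1 - (i / ((n : ℝ) - 1)) * x)) = S
  generalize (∑ i ∈ Finset.range (n - (j + 1)), 1 / (1 - (1 + i / ((n : ℝ) - 1)) * x)) = T
  push_cast
  field_simp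
  ring

lemma polyaP_symm (n k : ℕ) (hk : k ≤ n) (y : ℝ) :
    polyaP n k y = polyaP n (n - k) (1 - y) := by
  unfold polyaP
  rw [Nat.choose_symm hk, Nat.sub_sub_self hk, sub_sub_cancel, min_comm (1 - y) y]
  ring

/-- For `n ≥ 2` and `1 ≤ k ≤ n - 1`: for `x ∈ (0, 1/2)`, `p_{n,k}` is
differentiable at `x` with `p_{n,k}'(x) = p_{n,k}(x)·φ_{n,k}(x)/x`, and for
`x ∈ (1/2, 1)`, `p_{n,k}` is differentiable at `x` with
`p_{n,k}'(x) = −p_{n,k}(x)·φ_{n,n−k}(1−x)/(1−x)`. -/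
theorem polyaP_hasDerivAt (n k : ℕ) (hn : 2 ≤ n) (hk1 : 1 ≤ k) (hk2 : k ≤ n - 1) :
    (∀ x : ℝ, x ∈ Set.Ioo (0 : ℝ) (1 / 2) →
      HasDerivAt (fun y => polyaP n k y) (polyaP n k x * phi n k x / x) x) ∧
    (∀ x : ℝ, x ∈ Set.Ioo (1 / 2 : ℝ) 1 →
      HasDerivAt (fun y => polyaP n k y)
        (-(polyaP n k x * phi n (n - k) (1 - x) / (1 - x))) x) := by
  refine ⟨fun x hx => polyaP_left n k hn hk1 hk2 x hx.1 hx.2, fun x hx => ?_⟩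
  have h := polyaP_left n (n - k) hn (by omega) (by omega) (1 - x)
    (by linarith [hx.2]) (by linarith [hx.1])
  have h2 : HasDerivAt (fun y : ℝ => 1 - y) (-1) x := by
    simpa using (hasDerivAt_id x).const_sub 1
  have h3 := HasDerivAt.comp x h h2
  have hf : (fun y => polyaP n k y) = (fun y => polyaP n (n - k) y) ∘ (fun y : ℝ => 1 - y) := by
    funext y
    exact polyaP_symm n k (by omega) y
  rw [hf, polyaP_symm n k (by omega) x]
  exact h3.congr_deriv (by ring)
end
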